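/- Let u(z) = Re ∑_{n≥1} 2^n z^{2^{2^n}} / (z^{2^{2^n}} − 1) on the open unit disk 𝔻 (the series converges uniformly on compact subsets of 𝔻). Then for Lebesgue-almost every φ ∈ (−π, π], liminf_{R→1⁻} I_u(R,φ) / log log(1/(1−R)) > 0. -/

import Mathlib

open MeasureTheory Real Filter Set Metric

/-- The weighted radial average `I_u(R,φ)`. -/
noncomputable def Iu (u : ℂ → ℝ) (R φ : ℝ) : ℝ :=
  ∫ r in (1/2 : ℝ)..R, u ((r : ℂ) * Complex.exp (Complex.I * φ)) /
    ((1 - r) * (Real.log (1 / (1 - r))) ^ 2)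

/-- The function `u(z) = Re ∑_{n≥1} 2ⁿ z^(2^(2ⁿ)) / (z^(2^(2ⁿ)) − 1)`. -/
noncomputable def uNonOsc (z : ℂ) : ℝ :=
  (∑' n : ℕ, (2 : ℂ) ^ (n + 1) * z ^ (2 ^ (2 ^ (n + 1))) /
    (z ^ (2 ^ (2 ^ (n + 1))) - 1)).re

/-- The distance from `exp (iφ)` to `1` is controlled from below by the norm of `φ` modulo `2π`. -/
lemma norm_coe_addCircle_le (x : ℝ) :
    2 / π * ‖(x : AddCircle (2 * π))‖ ≤ ‖1 - Complex.exp (Complex.I * x)‖ := by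
  set k : ℤ := round ((2 * π)⁻¹ * x) with hk
  set y : ℝ := x - k * (2 * π) with hy
  have hpi := Real.pi_pos
  have hnorm : ‖(x : AddCircle (2 * π))‖ = |y| := by rw [AddCircle.norm_eq]
  have hyle : |y| ≤ π := by
    rw [← hnorm]
    have := AddCircle.norm_le_half_period (2 * π) (x := (x : AddCircle (2 * π))) (by positivity)
    rwa [abs_of_pos (by positivity), mul_div_cancel_left₀ _ (two_ne_zero)] at this
  have hexp : Complex.exp (Complex.I * x) = Complex.exp (Complex.I * y) := by
    rw [Complex.exp_eq_exp_iff_exists_int]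
    exact ⟨k, by rw [hy]; push_cast; ring⟩
  rw [hnorm, hexp, norm_sub_rev, Complex.norm_exp_I_mul_ofReal_sub_one, norm_mul, Real.norm_eq_abs,
    Real.norm_eq_abs, abs_two]
  have h := Real.mul_abs_le_abs_sin (x := y / 2) (by rw [abs_div, abs_two]; linarith)
  rw [abs_div, abs_two] at h
  have h2 : 2 / π * |y| = 2 * (2 / π * (|y| / 2)) := by ring
  rw [h2]
  gcongr

/-- Borel–Cantelli: along any sequence of integer frequencies, almost every point of the circle
stays away from `1` at a geometric rate. -/
lemma ae_exists_geometric_le_norm (N : ℕ → ℕ) (hN : ∀ n, 1 < N n) {ρ : ℝ} (h0 : 0 < ρ)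
    (h1 : ρ < 1) :
    ∀ᵐ φ ∂(volume.restrict (Ioc (-π) π)), ∃ c : ℝ, 0 < c ∧ c ≤ 1 ∧
      ∀ n, c * ρ ^ n ≤ ‖1 - Complex.exp (Complex.I * (φ : ℝ)) ^ N n‖ := by
  have : Fact (0 < 2 * π) := ⟨by positivity⟩
  have hpi := Real.pi_pos
  have hmp : ∀ n, MeasurePreserving (fun x : AddCircle (2 * π) => N n • x) :=
    fun n => (AddCircle.ergodic_nsmul (hN n)).toMeasurePreserving
  have hball : ∀ (n : ℕ) (ε : ℝ),
      volume ((fun x : AddCircle (2 * π) => N n • x) ⁻¹' closedBall 0 ε)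
        ≤ ENNReal.ofReal (2 * ε) := by
    intro n ε
    rw [(hmp n).measure_preimage measurableSet_closedBall.nullMeasurableSet,
      AddCircle.volume_closedBall]
    exact ENNReal.ofReal_le_ofReal (min_le_right _ _)
  have hev : ∀ᵐ x : AddCircle (2 * π), ∀ᶠ n in atTop,
      x ∉ (fun x : AddCircle (2 * π) => N n • x) ⁻¹' closedBall 0 (ρ ^ n) := by
    apply ae_eventually_notMem
    refine ne_top_of_le_ne_top ?_ (ENNReal.tsum_le_tsum fun n => hball n (ρ ^ n))
    rw [← ENNReal.ofReal_tsum_of_nonneg (fun n => by positivity)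
      ((summable_geometric_of_lt_one h0.le h1).mul_left 2)]
    exact ENNReal.ofReal_ne_top
  have hne : ∀ᵐ x : AddCircle (2 * π), ∀ n, N n • x ≠ 0 := by
    rw [ae_all_iff]
    intro n
    rw [ae_iff]
    have := hball n 0
    simpa [closedBall_zero, Set.preimage] using this
  have hq := (AddCircle.measurePreserving_mk (2 * π) (-π)).quasiMeasurePreserving.ae
    (hev.and hne)
  have hend : -π + 2 * π = π := by ring
  rw [hend] at hq
  filter_upwards [hq] with φ hφ
  obtain ⟨hφ1, hφ2⟩ := hφ
  set D : ℕ → ℝ := fun n => ‖1 - Complex.exp (Complex.I * (φ : ℝ)) ^ N n‖ with hD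
  have hDle : ∀ n, 2 / π * ‖N n • (φ : AddCircle (2 * π))‖ ≤ D n := by
    intro n
    have h := norm_coe_addCircle_le (N n * φ)
    have e1 : ((N n * φ : ℝ) : AddCircle (2 * π)) = N n • (φ : AddCircle (2 * π)) := by
      rw [← nsmul_eq_mul, AddCircle.coe_nsmul]
    have e2 : Complex.exp (Complex.I * ((N n * φ : ℝ) : ℂ))
        = Complex.exp (Complex.I * (φ : ℝ)) ^ N n := by
      rw [← Complex.exp_nat_mul]
      congr 1
      push_cast
      ring
    rw [e1, e2] at h
    exact h
  have hDpos : ∀ n, 0 < D n := fun n =>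
    lt_of_lt_of_le (mul_pos (by positivity) (norm_pos_iff.mpr (hφ2 n))) (hDle n)
  obtain ⟨n₀, hn₀⟩ := eventually_atTop.mp hφ1
  obtain ⟨c, hc, hcle⟩ : ∃ c : ℝ, 0 < c ∧ ∀ n < n₀, c ≤ D n := by
    rcases Nat.eq_zero_or_pos n₀ with h | h
    · exact ⟨1, one_pos, fun n hn => by omega⟩
    · obtain ⟨m, -, hm⟩ := Finset.exists_min_image (Finset.range n₀) D
        ⟨0, Finset.mem_range.mpr h⟩
      exact ⟨D m, hDpos m, fun n hn => hm n (Finset.mem_range.mpr hn)⟩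
  refine ⟨min (min c (2 / π)) 1, by positivity, min_le_right _ _, fun n => ?_⟩
  rcases lt_or_ge n n₀ with h | h
  · calc min (min c (2 / π)) 1 * ρ ^ n ≤ c * 1 := by
          gcongr
          · exact (min_le_left _ _).trans (min_le_left _ _)
          · exact pow_le_one₀ h0.le h1.le
      _ ≤ D n := by rw [mul_one]; exact hcle n h
  · have h3 := hn₀ n h
    simp only [Set.mem_preimage, mem_closedBall, dist_zero_right, not_le] at h3
    calc min (min c (2 / π)) 1 * ρ ^ n ≤ 2 / π * ‖N n • (φ : AddCircle (2 * π))‖ := by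
          gcongr
          exact (min_le_left _ _).trans (min_le_right _ _)
      _ ≤ D n := hDle n

/-- The lower bound on the unit circle persists, up to a factor `2`, along the radius. -/
lemma norm_one_sub_le_two_mul {q : ℂ} (hq : ‖q‖ = 1) {s : ℝ} (h0 : 0 ≤ s) (h1 : s ≤ 1) :
    ‖1 - q‖ ≤ 2 * ‖1 - s * q‖ := by
  have e : ‖(s : ℂ) * q‖ = s := by
    rw [norm_mul, hq, mul_one, Complex.norm_real, Real.norm_of_nonneg h0]
  have h2 : 1 - s ≤ ‖1 - s * q‖ := by
    have := norm_sub_norm_le (1 : ℂ) (s * q)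
    rwa [norm_one, e] at this
  have h3 : ‖(1 - s * q) - (1 - s : ℝ) * q‖ ≤ ‖1 - s * q‖ + (1 - s) := by
    refine (norm_sub_le _ _).trans_eq ?_
    rw [norm_mul, hq, mul_one, Complex.norm_real, Real.norm_of_nonneg (by linarith)]
  have h4 : (1 - s * q) - (1 - s : ℝ) * q = 1 - q := by push_cast; ring
  rw [h4] at h3
  linarith

lemma re_div_sub_one_sub_half {w : ℂ} (hw : w ≠ 1) :
    (w / (w - 1)).re - 1 / 2 = (‖w‖ ^ 2 - 1) / (2 * ‖1 - w‖ ^ 2) := by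
  have h : Complex.normSq (w - 1) ≠ 0 := by
    rw [Ne, Complex.normSq_eq_zero, sub_eq_zero]; exact hw
  rw [norm_sub_rev, ← Complex.normSq_eq_norm_sq, ← Complex.normSq_eq_norm_sq, Complex.div_re]
  field_simp
  simp only [Complex.normSq_apply, Complex.sub_re, Complex.sub_im, Complex.one_re, Complex.one_im]
  ring

/-- Each summand is close to the indicator function of `N (1 - r) < 1`, halved, with an error that
is integrable at scale `1 / N` after weighting. -/
lemma abs_re_div_sub_indicator_le {N : ℕ} (hN : 2 ≤ N) {x δ : ℝ} (hx : 0 < x) (hx2 : x ≤ 1 / 2)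
    {w : ℂ} (hw : ‖w‖ = (1 - x) ^ N) (hδ : 0 < δ) (hδ1 : δ ≤ 1) (hδw : δ ≤ ‖1 - w‖) :
    |(w / (w - 1)).re / (x * Real.log (1 / x) ^ 2) -
      (if N * x < 1 then 1 / 2 / (x * Real.log (1 / x) ^ 2) else 0)|
      ≤ 108 / (δ ^ 2 * Real.log N ^ 2) * (N / (1 + (N * x) ^ 2)) := by
  have hNr : (2 : ℝ) ≤ N := by exact_mod_cast hN
  have hL : 0 < Real.log N := Real.log_pos (by linarith)
  have hlog2 : (1 : ℝ) / 2 < Real.log 2 := by have := Real.log_two_gt_d9; linarith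
  have hy : Real.log 2 ≤ Real.log (1 / x) := by
    apply Real.log_le_log two_pos
    rw [le_div_iff₀ hx]; linarith
  have hy0 : 0 < Real.log (1 / x) := by linarith
  have hw1 : w ≠ 1 := by
    rintro rfl
    simp at hδw
    linarith
  have hwpos : 0 < ‖1 - w‖ := hδ.trans_le hδw
  set y := Real.log (1 / x) with hydef
  set L := Real.log N with hLdef
  split_ifs with hs
  · rw [← sub_div, re_div_sub_one_sub_half hw1, abs_div, abs_div, abs_of_nonneg (a := x * y ^ 2)
      (by positivity), abs_of_nonneg (a := 2 * ‖1 - w‖ ^ 2) (by positivity)]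
    have hb : 1 - N * x ≤ ‖w‖ := by
      rw [hw]
      have := one_add_mul_le_pow (a := -x) (by linarith) N
      rw [← sub_eq_add_neg] at this
      linarith
    have hle1 : ‖w‖ ≤ 1 := by
      rw [hw]; exact pow_le_one₀ (by linarith) (by linarith)
    have h1 : |‖w‖ ^ 2 - 1| ≤ 2 * (N * x) := by
      rw [abs_le]
      constructor <;> nlinarith [norm_nonneg w]
    have hLy : L ≤ y := by
      apply Real.log_le_log (by linarith)
      rw [le_div_iff₀ hx]; exact hs.le
    calc |‖w‖ ^ 2 - 1| / (2 * ‖1 - w‖ ^ 2) / (x * y ^ 2)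
        ≤ 2 * (N * x) / (2 * δ ^ 2) / (x * L ^ 2) := by gcongr
      _ = 1 / (δ ^ 2 * L ^ 2) * N := by field_simp
      _ ≤ 1 / (δ ^ 2 * L ^ 2) * (108 * (N / (1 + (N * x) ^ 2))) := by
          gcongr
          rw [← mul_div_assoc, le_div_iff₀ (by positivity)]
          have : (N * x) ^ 2 ≤ 1 := pow_le_one₀ (by positivity) hs.le
          nlinarith
      _ = _ := by ring
  · rw [sub_zero, abs_div, abs_of_nonneg (a := x * y ^ 2) (by positivity)]
    push Not at hs
    set s := N * x with hsdef
    have hs0 : 0 < s := by linarith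
    have hwe : ‖w‖ ≤ 6 / s ^ 3 := by
      have h1 : ‖w‖ ≤ Real.exp (-s) := by
        rw [hw, hsdef, ← mul_neg, Real.exp_nat_mul]
        exact pow_le_pow_left₀ (by linarith) (Real.one_sub_le_exp_neg x) N
      have h2 := Real.pow_div_factorial_le_exp s hs0.le 3
      have h3 : (0:ℝ) < s ^ 3 := by positivity
      rw [Real.exp_neg] at h1
      refine h1.trans ?_
      rw [inv_le_comm₀ (Real.exp_pos _) (by positivity), inv_div]
      norm_num [Nat.factorial] at h2
      exact h2
    have hre : |(w / (w - 1)).re| ≤ 6 / s ^ 3 / δ ^ 2 := by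
      refine (Complex.abs_re_le_norm _).trans ?_
      rw [norm_div, norm_sub_rev]
      gcongr
      refine le_trans ?_ hδw
      nlinarith
    have hLy : L ≤ 3 * s * y := by
      have h1 : L = y + Real.log s := by
        rw [hLdef, hydef, hsdef, ← Real.log_mul (by positivity) (by positivity)]
        congr 1
        field_simp
      have h2 := Real.log_le_sub_one_of_pos hs0
      nlinarith
    have hy2 : 1 / y ^ 2 ≤ 9 * s ^ 2 / L ^ 2 := by
      rw [div_le_div_iff₀ (by positivity) (by positivity)]
      have := pow_le_pow_left₀ hL.le hLy 2
      nlinarith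
    calc |(w / (w - 1)).re| / (x * y ^ 2) = |(w / (w - 1)).re| / x * (1 / y ^ 2) := by
          field_simp
      _ ≤ 6 / s ^ 3 / δ ^ 2 / x * (9 * s ^ 2 / L ^ 2) := by gcongr
      _ = 54 / (δ ^ 2 * L ^ 2) * (N / s ^ 2) := by
          have : (N : ℝ) = s / x := by rw [hsdef]; field_simp
          rw [this]; field_simp; norm_num
      _ ≤ 54 / (δ ^ 2 * L ^ 2) * (2 * (N / (1 + s ^ 2))) := by
          gcongr
          rw [← mul_div_assoc, div_le_div_iff₀ (by positivity) (by positivity)]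
          have : 1 ≤ s ^ 2 := one_le_pow₀ hs
          nlinarith
      _ = _ := by ring

lemma weight_pos {r : ℝ} (h0 : 1 / 2 ≤ r) (h1 : r < 1) :
    0 < (1 - r) * Real.log (1 / (1 - r)) ^ 2 := by
  have hx : 0 < 1 - r := by linarith
  have : 0 < Real.log (1 / (1 - r)) := by
    apply Real.log_pos
    rw [lt_div_iff₀ hx]; linarith
  positivity

lemma continuousOn_weight {R : ℝ} (h1 : R < 1) :
    ContinuousOn (fun r : ℝ => (1 - r) * Real.log (1 / (1 - r)) ^ 2) (Icc (1 / 2) R) := by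
  have h : ∀ r ∈ Icc (1 / 2) R, (1 - r) ≠ 0 := fun r hr => by linarith [hr.2]
  refine ContinuousOn.mul (by fun_prop) (ContinuousOn.pow (ContinuousOn.log ?_ ?_) 2)
  · exact ContinuousOn.div (by fun_prop) (by fun_prop) h
  · exact fun r hr => one_div_ne_zero (h r hr)

lemma setIntegral_inv_weight {a R : ℝ} (ha : 1 / 2 ≤ a) (haR : a ≤ R) (hR : R < 1) :
    ∫ r in Ioc a R, 1 / 2 / ((1 - r) * Real.log (1 / (1 - r)) ^ 2)
      = 1 / 2 * (1 / Real.log (1 / (1 - a)) - 1 / Real.log (1 / (1 - R))) := by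
  rw [← intervalIntegral.integral_of_le haR]
  rw [intervalIntegral.integral_eq_sub_of_hasDerivAt
    (f := fun r => -(1 / 2 * (1 / Real.log (1 / (1 - r)))))]
  · ring
  · intro r hr
    rw [uIcc_of_le haR] at hr
    have hx : 0 < 1 - r := by linarith [hr.2]
    have hy : 0 < Real.log (1 / (1 - r)) := by
      apply Real.log_pos
      rw [lt_div_iff₀ hx]; linarith [hr.1]
    have e : (fun r : ℝ => -(1 / 2 * (1 / Real.log (1 / (1 - r)))))
        = fun r => 1 / 2 * (Real.log (1 - r))⁻¹ := by
      funext r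
      rw [one_div (1 - r), Real.log_inv, one_div, one_div, inv_neg]; ring
    rw [e]
    rw [one_div (1 - r), Real.log_inv] at hy ⊢
    have hl : Real.log (1 - r) ≠ 0 := (neg_pos.mp hy).ne
    have h := ((((hasDerivAt_id r).const_sub 1).log hx.ne').inv hl).const_mul (1 / 2)
    refine h.congr_deriv ?_
    simp only [id]
    field_simp
  · apply ContinuousOn.intervalIntegrable
    rw [uIcc_of_le haR]
    refine continuousOn_const.div ((continuousOn_weight hR).mono (Icc_subset_Icc_left ha)) ?_
    exact fun r hr => (weight_pos (ha.trans hr.1) (hr.2.trans_lt hR)).ne'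

/-- The weighted integral of the limiting profile of a single summand. -/
lemma setIntegral_ite_inv_weight {N : ℕ} (hN : 2 ≤ N) {R : ℝ} (h0 : 1 / 2 < R) (hR : R < 1) :
    ∫ r in Ioc (1 / 2) R,
        (if N * (1 - r) < 1 then 1 / 2 / ((1 - r) * Real.log (1 / (1 - r)) ^ 2) else 0)
      = if Real.log N < Real.log (1 / (1 - R)) then
          1 / 2 * (1 / Real.log N - 1 / Real.log (1 / (1 - R))) else 0 := by
  have hNr : (2 : ℝ) ≤ N := by exact_mod_cast hN
  have hN0 : (0 : ℝ) < N := by linarith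
  have hind : ∀ r : ℝ, N * (1 - r) < 1 ↔ 1 - 1 / N < r := by
    intro r
    rw [sub_lt_comm, lt_div_iff₀ hN0, mul_comm]
  have ha : (1 : ℝ) / 2 ≤ 1 - 1 / N := by
    have : (1 : ℝ) / N ≤ 1 / 2 := by gcongr
    linarith
  have hlog : Real.log N < Real.log (1 / (1 - R)) ↔ 1 - 1 / N < R := by
    rw [Real.log_lt_log_iff hN0 (by apply one_div_pos.mpr; linarith), lt_div_iff₀ (by linarith),
      hind]
  have e : (fun r : ℝ => if N * (1 - r) < 1 then
      1 / 2 / ((1 - r) * Real.log (1 / (1 - r)) ^ 2) else 0)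
      = (Ioi (1 - 1 / (N : ℝ))).indicator
        (fun r => 1 / 2 / ((1 - r) * Real.log (1 / (1 - r)) ^ 2)) := by
    funext r
    simp only [Set.indicator, mem_Ioi, hind]
  rw [e, setIntegral_indicator measurableSet_Ioi, Ioc_inter_Ioi, sup_eq_right.mpr ha]
  split_ifs with h
  · rw [setIntegral_inv_weight ha (hlog.mp h).le hR]
    congr 4
    rw [sub_sub_cancel, one_div_one_div]
  · rw [hlog] at h
    rw [Ioc_eq_empty h, setIntegral_empty]

lemma integrableOn_ite_inv_weight (N : ℕ) {R : ℝ} (hR : R < 1) :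
    IntegrableOn (fun r : ℝ => if N * (1 - r) < 1 then
      1 / 2 / ((1 - r) * Real.log (1 / (1 - r)) ^ 2) else 0) (Ioc (1 / 2) R) := by
  have h : IntegrableOn (fun r : ℝ => 1 / 2 / ((1 - r) * Real.log (1 / (1 - r)) ^ 2))
      (Ioc (1 / 2) R) := by
    refine IntegrableOn.mono_set (ContinuousOn.integrableOn_Icc ?_) Ioc_subset_Icc_self
    exact continuousOn_const.div (continuousOn_weight hR)
      fun r hr => (weight_pos hr.1 (hr.2.trans_lt hR)).ne'
  have hm : MeasurableSet {r : ℝ | N * (1 - r) < 1} :=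
    measurableSet_lt (by fun_prop) measurable_const
  exact h.indicator hm

lemma integrableOn_cauchy_kernel (N : ℕ) (R : ℝ) :
    IntegrableOn (fun r : ℝ => N / (1 + (N * (1 - r)) ^ 2)) (Ioc (1 / 2) R) := by
  refine IntegrableOn.mono_set (ContinuousOn.integrableOn_Icc ?_) Ioc_subset_Icc_self
  refine Continuous.continuousOn (continuous_const.div (by fun_prop) fun r => ?_)
  positivity

lemma setIntegral_cauchy_kernel_le (N : ℕ) {R : ℝ} (h0 : 1 / 2 < R) :
    ∫ r in Ioc (1 / 2) R, N / (1 + (N * (1 - r)) ^ 2) ≤ π := by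
  rw [← intervalIntegral.integral_of_le h0.le]
  rw [intervalIntegral.integral_eq_sub_of_hasDerivAt
    (f := fun r => -Real.arctan (N * (1 - r)))]
  · have h1 := Real.arctan_lt_pi_div_two (N * (1 - 1 / 2))
    have h2 := Real.neg_pi_div_two_lt_arctan (N * (1 - R))
    linarith
  · intro r _
    have h := (((hasDerivAt_id r).const_sub 1).const_mul (N : ℝ)).arctan.neg
    refine h.congr_deriv ?_
    simp only [id]
    field_simp
  · refine Continuous.intervalIntegrable (continuous_const.div (by fun_prop) fun r => ?_) _ _
    positivity

lemma integrableOn_re_div_weight {p : ℂ} (hp : ‖p‖ = 1) {N : ℕ} (hN : N ≠ 0) {R : ℝ}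
    (hR : R < 1) :
    IntegrableOn (fun r : ℝ => ((r * p) ^ N / ((r * p) ^ N - 1)).re /
      ((1 - r) * Real.log (1 / (1 - r)) ^ 2)) (Ioc (1 / 2) R) := by
  refine IntegrableOn.mono_set (ContinuousOn.integrableOn_Icc ?_) Ioc_subset_Icc_self
  refine ContinuousOn.div ?_ (continuousOn_weight hR)
    fun r hr => (weight_pos hr.1 (hr.2.trans_lt hR)).ne'
  refine Complex.continuous_re.comp_continuousOn (ContinuousOn.div (by fun_prop) (by fun_prop) ?_)
  intro r hr h
  have h1 : ‖((r : ℂ) * p) ^ N‖ = 1 := by rw [sub_eq_zero.mp h, norm_one]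
  have h0 : 0 ≤ r := by linarith [hr.1]
  rw [norm_pow, norm_mul, hp, mul_one, Complex.norm_real, Real.norm_of_nonneg h0] at h1
  exact (pow_lt_one₀ h0 (hr.2.trans_lt hR) hN).ne h1

lemma abs_re_div_weight_sub_le {p : ℂ} (hp : ‖p‖ = 1) {N : ℕ} (hN : 2 ≤ N) {δ : ℝ} (hδ : 0 < δ)
    (hδ1 : δ ≤ 1) (hδp : 2 * δ ≤ ‖1 - p ^ N‖) {r : ℝ} (h0 : 1 / 2 ≤ r) (h1 : r < 1) :
    |((r * p) ^ N / ((r * p) ^ N - 1)).re / ((1 - r) * Real.log (1 / (1 - r)) ^ 2) -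
      (if N * (1 - r) < 1 then 1 / 2 / ((1 - r) * Real.log (1 / (1 - r)) ^ 2) else 0)|
      ≤ 108 / (δ ^ 2 * Real.log N ^ 2) * (N / (1 + (N * (1 - r)) ^ 2)) := by
  have hr0 : 0 ≤ r := by linarith
  apply abs_re_div_sub_indicator_le hN (by linarith) (by linarith) ?_ hδ hδ1
  · have := norm_one_sub_le_two_mul (q := p ^ N) (by rw [norm_pow, hp, one_pow])
      (pow_nonneg hr0 N) (pow_le_one₀ hr0 h1.le)
    rw [mul_pow, ← Complex.ofReal_pow]
    linarith
  · rw [norm_pow, norm_mul, hp, mul_one, Complex.norm_real, Real.norm_of_nonneg hr0,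
      sub_sub_cancel]

/-- The weighted integral of a single summand is that of its limiting profile up to a controlled
error. -/
lemma abs_setIntegral_sub_le {p : ℂ} (hp : ‖p‖ = 1) {N : ℕ} (hN : 2 ≤ N) {δ : ℝ} (hδ : 0 < δ)
    (hδ1 : δ ≤ 1) (hδp : 2 * δ ≤ ‖1 - p ^ N‖) {R : ℝ} (h0 : 1 / 2 < R) (h1 : R < 1) :
    |(∫ r in Ioc (1 / 2) R, ((r * p) ^ N / ((r * p) ^ N - 1)).re /
        ((1 - r) * Real.log (1 / (1 - r)) ^ 2)) -
      (if Real.log N < Real.log (1 / (1 - R)) then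
          1 / 2 * (1 / Real.log N - 1 / Real.log (1 / (1 - R))) else 0)|
      ≤ 108 * π / (δ ^ 2 * Real.log N ^ 2) := by
  rw [← setIntegral_ite_inv_weight hN h0 h1,
    ← integral_sub (integrableOn_re_div_weight hp (by omega) h1) (integrableOn_ite_inv_weight N h1)]
  calc _ ≤ ∫ r in Ioc (1 / 2) R,
        108 / (δ ^ 2 * Real.log N ^ 2) * (N / (1 + (N * (1 - r)) ^ 2)) := by
        rw [← Real.norm_eq_abs]
        refine norm_integral_le_of_norm_le ((integrableOn_cauchy_kernel N R).const_mul _) ?_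
        refine (ae_restrict_iff' measurableSet_Ioc).mpr (Eventually.of_forall fun r hr => ?_)
        rw [Real.norm_eq_abs]
        exact abs_re_div_weight_sub_le hp hN hδ hδ1 hδp hr.1.le (hr.2.trans_lt h1)
    _ ≤ 108 / (δ ^ 2 * Real.log N ^ 2) * π := by
        rw [integral_const_mul]
        gcongr
        exact setIntegral_cauchy_kernel_le N h0
    _ = _ := by ring

lemma setIntegral_abs_le {p : ℂ} (hp : ‖p‖ = 1) {N : ℕ} (hN : 2 ≤ N) {δ : ℝ} (hδ : 0 < δ)
    (hδ1 : δ ≤ 1) (hδp : 2 * δ ≤ ‖1 - p ^ N‖) {R : ℝ} (h0 : 1 / 2 < R) (h1 : R < 1) :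
    (∫ r in Ioc (1 / 2) R, |((r * p) ^ N / ((r * p) ^ N - 1)).re /
        ((1 - r) * Real.log (1 / (1 - r)) ^ 2)|)
      ≤ (if Real.log N < Real.log (1 / (1 - R)) then
          1 / 2 * (1 / Real.log N - 1 / Real.log (1 / (1 - R))) else 0) +
        108 * π / (δ ^ 2 * Real.log N ^ 2) := by
  rw [← setIntegral_ite_inv_weight hN h0 h1]
  have hc := (integrableOn_cauchy_kernel N R).const_mul (108 / (δ ^ 2 * Real.log N ^ 2))
  calc _ ≤ ∫ r in Ioc (1 / 2) R,
        ((if N * (1 - r) < 1 then 1 / 2 / ((1 - r) * Real.log (1 / (1 - r)) ^ 2) else 0) +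
        108 / (δ ^ 2 * Real.log N ^ 2) * (N / (1 + (N * (1 - r)) ^ 2))) := by
        refine setIntegral_mono_on (integrableOn_re_div_weight hp (by omega) h1).abs
          ((integrableOn_ite_inv_weight N h1).add hc) measurableSet_Ioc fun r hr => ?_
        have h := abs_re_div_weight_sub_le hp hN hδ hδ1 hδp hr.1.le (hr.2.trans_lt h1)
        have hw := weight_pos hr.1.le (hr.2.trans_lt h1)
        have h2 := abs_sub_abs_le_abs_sub (((r * p) ^ N / ((r * p) ^ N - 1)).re /
          ((1 - r) * Real.log (1 / (1 - r)) ^ 2))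
          (if N * (1 - r) < 1 then 1 / 2 / ((1 - r) * Real.log (1 / (1 - r)) ^ 2) else 0)
        rw [abs_of_nonneg (a := if N * (1 - r) < 1 then
          1 / 2 / ((1 - r) * Real.log (1 / (1 - r)) ^ 2) else 0)
          (by split_ifs <;> positivity)] at h2
        linarith
    _ ≤ _ := by
        rw [integral_add (integrableOn_ite_inv_weight N h1) hc, integral_const_mul]
        have : 108 * π / (δ ^ 2 * Real.log N ^ 2) = 108 / (δ ^ 2 * Real.log N ^ 2) * π := by ring
        rw [this]
        gcongr
        exact setIntegral_cauchy_kernel_le N h0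

/-- The contribution of the `n`-th summand to the weighted average, as a function of
`T = log (1 / (1 - R))`, when the radial oscillation is ignored. -/
noncomputable def profile (n : ℕ) (T : ℝ) : ℝ :=
  if 2 ^ (n + 1) * Real.log 2 < T then 1 / 2 * (1 / Real.log 2 - 2 ^ (n + 1) / T) else 0

lemma half_lt_log_two : (1 : ℝ) / 2 < Real.log 2 := by
  have := Real.log_two_gt_d9
  linarith

lemma profile_nonneg (n : ℕ) (T : ℝ) : 0 ≤ profile n T := by
  have hl : (0 : ℝ) < Real.log 2 := Real.log_pos one_lt_two
  unfold profile
  split_ifs with h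
  · have hT : 0 < T := lt_trans (by positivity) h
    have : 2 ^ (n + 1) / T ≤ 1 / Real.log 2 := by
      rw [div_le_div_iff₀ hT hl]
      linarith
    linarith
  · exact le_rfl

lemma profile_le_one (n : ℕ) (T : ℝ) : profile n T ≤ 1 := by
  have hl := half_lt_log_two
  unfold profile
  split_ifs with h
  · have hT : 0 < T := lt_trans (by positivity) h
    have h1 : 1 / Real.log 2 ≤ 2 := by
      rw [div_le_iff₀ (by linarith)]; linarith
    have h2 : 0 ≤ 2 ^ (n + 1) / T := by positivity
    linarith
  · exact zero_le_one

lemma profile_eq_zero {n : ℕ} {T : ℝ} (h : T ≤ 2 ^ n) : profile n T = 0 := by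
  have hl := half_lt_log_two
  rw [profile, if_neg]
  rw [not_lt, pow_succ]
  have : (0 : ℝ) < 2 ^ n := by positivity
  nlinarith

lemma quarter_le_profile {n : ℕ} {T : ℝ} (h : 2 ^ (n + 2) ≤ T) : 1 / 4 ≤ profile n T := by
  have hl := half_lt_log_two
  have hl1 : Real.log 2 < 1 := by have := Real.log_two_lt_d9; linarith
  have hp : (0 : ℝ) < 2 ^ (n + 1) := by positivity
  rw [pow_succ] at h
  have hT : 0 < T := by linarith
  rw [profile, if_pos (by nlinarith)]
  have h1 : 1 ≤ 1 / Real.log 2 := by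
    rw [le_div_iff₀ (by linarith)]; linarith
  have h2 : 2 ^ (n + 1) / T ≤ 1 / 2 := by
    rw [div_le_div_iff₀ hT two_pos]; linarith
  linarith

lemma profile_support {M : ℕ} {T : ℝ} (h : T ≤ 2 ^ M) :
    ∀ n ∉ Finset.range M, profile n T = 0 := by
  intro n hn
  rw [Finset.mem_range, not_lt] at hn
  exact profile_eq_zero (h.trans (pow_le_pow_right₀ one_le_two hn))

lemma summable_profile (T : ℝ) : Summable fun n => profile n T := by
  obtain ⟨M, hM⟩ := pow_unbounded_of_one_lt T one_lt_two
  exact summable_of_ne_finset_zero (profile_support hM.le)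

lemma log_le_tsum_profile {T : ℝ} (hT : 1 ≤ T) :
    Real.log T / 4 - 1 ≤ ∑' n, profile n T := by
  obtain ⟨M, h1, h2⟩ := exists_nat_pow_near hT one_lt_two
  have hl1 : Real.log 2 < 1 := by have := Real.log_two_lt_d9; linarith
  have hlog : Real.log T ≤ M + 1 := by
    have := Real.log_le_log (by linarith) h2.le
    rw [Real.log_pow] at this
    push_cast at this
    nlinarith
  have hsum : ((M - 1 : ℕ) : ℝ) * (1 / 4) ≤ ∑' n, profile n T := by
    refine le_trans ?_ ((summable_profile T).sum_le_tsum (Finset.range (M - 1))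
      fun n _ => profile_nonneg n T)
    rw [← nsmul_eq_mul]
    refine (Finset.card_nsmul_le_sum _ _ _ fun n hn => ?_).trans_eq' (by rw [Finset.card_range])
    rw [Finset.mem_range] at hn
    exact quarter_le_profile ((pow_le_pow_right₀ one_le_two (by omega)).trans h1)
  have : (M : ℝ) ≤ ((M - 1 : ℕ) : ℝ) + 1 := by exact_mod_cast (by omega : M ≤ M - 1 + 1)
  linarith

lemma tsum_profile_le_log {T : ℝ} (hT : 1 ≤ T) :
    ∑' n, profile n T ≤ 2 * Real.log T + 1 := by
  obtain ⟨M, h1, h2⟩ := exists_nat_pow_near hT one_lt_two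
  have hl := half_lt_log_two
  have hlog : (M : ℝ) / 2 ≤ Real.log T := by
    have := Real.log_le_log (by positivity) h1
    rw [Real.log_pow] at this
    have hM : (0 : ℝ) ≤ M := by positivity
    nlinarith
  rw [tsum_eq_sum (profile_support h2.le)]
  have := Finset.sum_le_card_nsmul (Finset.range (M + 1)) (fun n => profile n T) 1
    fun n _ => profile_le_one n T
  rw [Finset.card_range, nsmul_eq_mul] at this
  push_cast at this
  linarith

lemma summable_lacunary {z : ℂ} (hz : ‖z‖ < 1) :
    Summable fun n : ℕ => (2 : ℂ) ^ (n + 1) * z ^ (2 ^ (2 ^ (n + 1))) /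
      (z ^ (2 ^ (2 ^ (n + 1))) - 1) := by
  have hinj : Function.Injective fun n : ℕ => 2 ^ (2 ^ (n + 1)) := by
    intro a b h
    have := Nat.pow_right_injective le_rfl (Nat.pow_right_injective le_rfl h)
    omega
  have hs : Summable fun k : ℕ => (k : ℝ) ^ 1 * ‖z‖ ^ k :=
    summable_pow_mul_geometric_of_norm_lt_one 1 (by rwa [norm_norm])
  refine Summable.of_norm_bounded ((hs.comp_injective hinj).mul_right (1 - ‖z‖)⁻¹) fun n => ?_
  have hle : ‖z‖ ^ (2 ^ (2 ^ (n + 1))) ≤ ‖z‖ :=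
    pow_le_of_le_one (norm_nonneg z) hz.le (by positivity)
  have hden : 1 - ‖z‖ ≤ ‖z ^ (2 ^ (2 ^ (n + 1))) - 1‖ := by
    have := norm_sub_norm_le (1 : ℂ) (z ^ (2 ^ (2 ^ (n + 1))))
    rw [norm_one, norm_pow, norm_sub_rev] at this
    linarith
  have h2 : (2 : ℝ) ^ (n + 1) ≤ 2 ^ (2 ^ (n + 1)) :=
    pow_le_pow_right₀ one_le_two Nat.lt_two_pow_self.le
  rw [norm_div, norm_mul, norm_pow, norm_pow, Complex.norm_two, div_eq_mul_inv]
  simp only [Function.comp_apply, pow_one, Nat.cast_pow, Nat.cast_ofNat]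
  have : 0 < 1 - ‖z‖ := by linarith
  gcongr

lemma uNonOsc_eq_tsum {z : ℂ} (hz : ‖z‖ < 1) :
    uNonOsc z = ∑' n : ℕ, (2 : ℝ) ^ (n + 1) *
      (z ^ (2 ^ (2 ^ (n + 1))) / (z ^ (2 ^ (2 ^ (n + 1))) - 1)).re := by
  rw [uNonOsc, Complex.re_tsum (summable_lacunary hz)]
  congr 1
  funext n
  rw [mul_div_assoc, ← Complex.re_ofReal_mul]
  push_cast
  rfl

/-- On rays satisfying the geometric lower bound, the weighted average is the sum of the profiles
up to a bounded error. -/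
lemma exists_abs_Iu_sub_tsum_profile_le {φ c : ℝ} (hc : 0 < c) (hc1 : c ≤ 1)
    (h : ∀ n, c * (3 / 4) ^ n ≤ ‖1 - Complex.exp (Complex.I * φ) ^ (2 ^ (2 ^ (n + 1)))‖) :
    ∃ C : ℝ, ∀ R, 1 / 2 < R → R < 1 →
      |Iu uNonOsc R φ - ∑' n, profile n (Real.log (1 / (1 - R)))| ≤ C := by
  set p : ℂ := Complex.exp (Complex.I * φ) with hpdef
  have hp : ‖p‖ = 1 := Complex.norm_exp_I_mul_ofReal φ
  have hl : (0 : ℝ) < Real.log 2 := Real.log_pos one_lt_two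
  set K : ℝ := 216 * π / (c ^ 2 * Real.log 2 ^ 2) with hK
  have hgeo : Summable fun n : ℕ => K * (8 / 9 : ℝ) ^ n :=
    (summable_geometric_of_lt_one (by norm_num) (by norm_num)).mul_left K
  refine ⟨∑' n : ℕ, K * (8 / 9 : ℝ) ^ n, fun R h0 h1 => ?_⟩
  set T : ℝ := Real.log (1 / (1 - R)) with hT
  have hT0 : 0 < T := by
    apply Real.log_pos
    rw [lt_div_iff₀ (by linarith)]; linarith
  set δ : ℕ → ℝ := fun n => c / 2 * (3 / 4) ^ n with hδdef
  have hδ : ∀ n, 0 < δ n := fun n => by positivity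
  have hpow1 : ∀ n : ℕ, (3 / 4 : ℝ) ^ n ≤ 1 := fun n => pow_le_one₀ (by norm_num) (by norm_num)
  have hδ1 : ∀ n, δ n ≤ 1 := fun n => by
    have := hpow1 n
    have : (0 : ℝ) < (3 / 4) ^ n := by positivity
    simp only [hδdef]
    nlinarith
  have hδp : ∀ n, 2 * δ n ≤ ‖1 - p ^ (2 ^ (2 ^ (n + 1)))‖ := fun n => by
    refine le_trans (le_of_eq ?_) (h n)
    simp only [hδdef]
    ring
  have hN : ∀ n : ℕ, 2 ≤ 2 ^ (2 ^ (n + 1)) := fun n =>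
    le_self_pow₀ (by norm_num) (by positivity)
  have hlogN : ∀ n : ℕ, Real.log ((2 ^ (2 ^ (n + 1)) : ℕ) : ℝ) = 2 ^ (n + 1) * Real.log 2 := by
    intro n
    push_cast
    rw [Real.log_pow]
    push_cast
    rfl
  have hprof : ∀ n : ℕ, 2 ^ (n + 1) *
      (if Real.log ((2 ^ (2 ^ (n + 1)) : ℕ) : ℝ) < T then
        1 / 2 * (1 / Real.log ((2 ^ (2 ^ (n + 1)) : ℕ) : ℝ) - 1 / T) else 0) = profile n T := by
    intro n
    rw [hlogN, profile, mul_ite, mul_zero]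
    congr 1
    field_simp
  have herr : ∀ n : ℕ, 2 ^ (n + 1) * (108 * π /
      (δ n ^ 2 * Real.log ((2 ^ (2 ^ (n + 1)) : ℕ) : ℝ) ^ 2)) = K * (8 / 9) ^ n := by
    intro n
    have e : (8 / 9 : ℝ) ^ n = ((3 / 4 : ℝ) ^ n)⁻¹ ^ 2 / 2 ^ n := by
      rw [← inv_pow, pow_right_comm, ← div_pow]
      norm_num
    rw [hlogN, e, hK]
    simp only [hδdef]
    have h34 : (3 / 4 : ℝ) ^ n ≠ 0 := by positivity
    generalize (3 / 4 : ℝ) ^ n = y at h34 ⊢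
    rw [pow_succ]
    field_simp
    norm_num
  set f : ℕ → ℝ → ℝ := fun n r => ((r * p) ^ (2 ^ (2 ^ (n + 1))) /
    ((r * p) ^ (2 ^ (2 ^ (n + 1))) - 1)).re / ((1 - r) * Real.log (1 / (1 - r)) ^ 2) with hf
  have hsum : HasSum (fun n => ∫ r in Ioc (1 / 2) R, 2 ^ (n + 1) * f n r)
      (∫ r in Ioc (1 / 2) R, ∑' n, 2 ^ (n + 1) * f n r) := by
    refine hasSum_integral_of_summable_integral_norm
      (fun n => (integrableOn_re_div_weight hp (by positivity) h1).const_mul _) ?_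
    refine Summable.of_nonneg_of_le (fun n => integral_nonneg fun r => norm_nonneg _)
      (fun n => ?_) ((summable_profile T).add hgeo)
    have hb := setIntegral_abs_le hp (hN n) (hδ n) (hδ1 n) (hδp n) h0 h1
    simp_rw [norm_mul, integral_const_mul, Real.norm_eq_abs]
    rw [abs_of_nonneg (by positivity), ← hprof, ← herr, ← mul_add]
    gcongr
  have hIu : Iu uNonOsc R φ = ∫ r in Ioc (1 / 2) R, ∑' n, 2 ^ (n + 1) * f n r := by
    rw [Iu, intervalIntegral.integral_of_le h0.le]
    refine setIntegral_congr_fun measurableSet_Ioc fun r hr => ?_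
    have hr0 : 0 ≤ r := by linarith [hr.1]
    have hz : ‖(r : ℂ) * p‖ < 1 := by
      rw [norm_mul, hp, mul_one, Complex.norm_real, Real.norm_of_nonneg hr0]
      exact hr.2.trans_lt h1
    rw [← hpdef, uNonOsc_eq_tsum hz, ← tsum_div_const]
    simp only [hf, mul_div_assoc]
  rw [hIu, ← hsum.tsum_eq, ← hsum.summable.tsum_sub (summable_profile T), ← Real.norm_eq_abs]
  refine tsum_of_norm_bounded hgeo.hasSum fun n => ?_
  have hb := abs_setIntegral_sub_le hp (hN n) (hδ n) (hδ1 n) (hδp n) h0 h1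
  rw [integral_const_mul, ← hprof, ← herr, ← mul_sub, norm_mul, Real.norm_of_nonneg (by positivity),
    Real.norm_eq_abs]
  gcongr

theorem stmt_6 :
    ∀ᵐ φ ∂(volume.restrict (Ioc (-π) π)),
      0 < Filter.liminf
        (fun R : ℝ => Iu uNonOsc R φ / Real.log (Real.log (1 / (1 - R))))
        (nhdsWithin 1 (Iio 1)) := by
  filter_upwards [ae_exists_geometric_le_norm (fun n => 2 ^ (2 ^ (n + 1)))
    (fun n => Nat.one_lt_two_pow (by positivity)) (ρ := 3 / 4) (by norm_num) (by norm_num)]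
    with φ hφ
  obtain ⟨c, hc, hc1, h⟩ := hφ
  obtain ⟨C, hC⟩ := exists_abs_Iu_sub_tsum_profile_le hc hc1 h
  have hlim : Tendsto (fun R : ℝ => Real.log (1 / (1 - R))) (nhdsWithin 1 (Iio 1)) atTop := by
    refine Real.tendsto_log_atTop.comp ?_
    simp_rw [one_div]
    refine tendsto_inv_nhdsGT_zero.comp (tendsto_nhdsWithin_iff.mpr ⟨?_, ?_⟩)
    · have : Tendsto (fun R : ℝ => 1 - R) (nhds 1) (nhds (1 - 1)) := by
        exact (continuous_const.sub continuous_id).tendsto 1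
      rw [sub_self] at this
      exact this.mono_left nhdsWithin_le_nhds
    · filter_upwards [self_mem_nhdsWithin] with R hR
      exact mem_Ioi.mpr (sub_pos.mpr (mem_Iio.mp hR))
  have hlim2 := Real.tendsto_log_atTop.comp hlim
  have hhalf : ∀ᶠ R : ℝ in nhdsWithin 1 (Iio 1), 1 / 2 < R :=
    nhdsWithin_le_nhds (Ioi_mem_nhds (by norm_num))
  have hbounds : ∀ᶠ R : ℝ in nhdsWithin 1 (Iio 1),
      1 / 8 ≤ Iu uNonOsc R φ / Real.log (Real.log (1 / (1 - R))) ∧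
      Iu uNonOsc R φ / Real.log (Real.log (1 / (1 - R))) ≤ 3 := by
    filter_upwards [hhalf, self_mem_nhdsWithin, hlim.eventually_ge_atTop 1,
      hlim2.eventually_ge_atTop (max 1 (8 * (C + 1)))] with R h0 h1 hT hlog
    simp only [Function.comp_apply] at hlog
    have hl1 := (le_max_left _ _).trans hlog
    have hl2 := (le_max_right _ _).trans hlog
    have hb := abs_le.mp (hC R h0 h1)
    have hCn : 0 ≤ C := (abs_nonneg _).trans (hC R h0 h1)
    have hlow := log_le_tsum_profile hT
    have hup := tsum_profile_le_log hT
    constructor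
    · rw [le_div_iff₀ (by linarith)]
      linarith [hb.1]
    · rw [div_le_iff₀ (by linarith)]
      linarith [hb.2]
  refine lt_of_lt_of_le (by norm_num : (0 : ℝ) < 1 / 8)
    (le_liminf_of_le ?_ (hbounds.mono fun R hR => hR.1))
  exact IsBoundedUnder.isCoboundedUnder_ge ⟨3, hbounds.mono fun R hR => hR.2⟩
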